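/- Suppose F is a finite field with q elements. Let A_1 = (p_1, H_1) and A_2 = (p_2, H_2) be distinct point-hyperplane anti-flags with ¬(A_1 ~_1 A_2). Then: (1) if A_1 ~_2 A_2, then |{A_1, A_2}^{~_1}| = 4(q^{n-2} - 1)(q - 1)q^{n-3}; (2) if A_1 ~_3 A_2, then |{A_1, A_2}^{~_1}| = q^{2n-3} - 2q^{n-2}. -/

import Mathlib

/-- A point-hyperplane anti-flag of `PG(n-1,F)`: a pair `(p, H)` where `p` is a point
(1-dimensional subspace of `F^n`), `H` is a hyperplane ((n-1)-dimensional subspace),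
and `p` is not contained in `H`. -/
structure AntiFlag (F : Type*) [Field F] (n : ℕ) where
  pt : Submodule F (Fin n → F)
  hyp : Submodule F (Fin n → F)
  pt_rank : Module.finrank F pt = 1
  hyp_rank : Module.finrank F hyp = n - 1
  not_incident : ¬ pt ≤ hyp

variable {F : Type*} [Field F] {n : ℕ}

/-- `A ~₁ B` : for some `j`, `p_j ⊆ H_{3-j}` and `p_{3-j} ⊄ H_j`. -/
def adj1 (A B : AntiFlag F n) : Prop :=
  A ≠ B ∧ ((A.pt ≤ B.hyp ∧ ¬ B.pt ≤ A.hyp) ∨ (B.pt ≤ A.hyp ∧ ¬ A.pt ≤ B.hyp))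

/-- `A ~₂ B` : `p_1 ⊆ H_2` and `p_2 ⊆ H_1`. -/
def adj2 (A B : AntiFlag F n) : Prop :=
  A ≠ B ∧ A.pt ≤ B.hyp ∧ B.pt ≤ A.hyp

/-- `A ~₃ B` : `p_1 = p_2` or `H_1 = H_2`. -/
def adj3 (A B : AntiFlag F n) : Prop :=
  A ≠ B ∧ (A.pt = B.pt ∨ A.hyp = B.hyp)

/-- `A ~₄ B` : `p_1 ≠ p_2`, `H_1 ≠ H_2`, `p_1 ⊄ H_2` and `p_2 ⊄ H_1`. -/
def adj4 (A B : AntiFlag F n) : Prop :=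
  A ≠ B ∧ A.pt ≠ B.pt ∧ A.hyp ≠ B.hyp ∧ ¬ A.pt ≤ B.hyp ∧ ¬ B.pt ≤ A.hyp

/-- `𝒳^{~ᵢ}` : the set of anti-flags `i`-adjacent to every anti-flag of `𝒳`. -/
def perpSet (adj : AntiFlag F n → AntiFlag F n → Prop) (X : Set (AntiFlag F n)) :
    Set (AntiFlag F n) := {B | ∀ A ∈ X, adj A B}

open Module

/-- An affine system of `k` independent linear equations over a finite field has
`q ^ (n - k)` solutions. -/
theorem card_filter_dotProduct_eq [Fintype F] [DecidableEq F] {k : ℕ}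
    (w : Fin k → Fin n → F) (hw : LinearIndependent F w) (y : Fin k → F) :
    (Finset.univ.filter fun f : Fin n → F => ∀ i, w i ⬝ᵥ f = y i).card =
      Fintype.card F ^ (n - k) := by
  set L : (Fin n → F) →ₗ[F] (Fin k → F) := (Matrix.of w).mulVecLin with hL
  have hLa : ∀ f i, L f i = w i ⬝ᵥ f := fun f i => rfl
  have hr : finrank F (LinearMap.range L) = k := by
    have := LinearIndependent.rank_matrix (M := Matrix.of w) hw
    simpa [Matrix.rank] using this
  have hsurj : Function.Surjective L := by
    rw [← LinearMap.range_eq_top]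
    apply Submodule.eq_top_of_finrank_eq
    simp [hr]
  have hker : finrank F (LinearMap.ker L) = n - k := by
    have := LinearMap.finrank_range_add_finrank_ker L
    simp only [finrank_fin_fun] at this
    omega
  obtain ⟨f₀, hf₀⟩ := hsurj y
  have : Fintype (LinearMap.ker L) := Fintype.ofFinite _
  have hcard : Fintype.card (LinearMap.ker L) = Fintype.card F ^ (n - k) := by
    rw [← hker]; exact Module.card_eq_pow_finrank
  rw [← hcard, ← Finset.card_univ]
  symm
  refine Finset.card_bij (fun x _ => x.1 + f₀) ?_ ?_ ?_
  · rintro ⟨x, hx⟩ -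
    have h : L (x + f₀) = y := by rw [map_add, LinearMap.mem_ker.1 hx, hf₀, zero_add]
    simpa using fun i => (hLa (x + f₀) i).symm.trans (congrFun h i)
  · rintro ⟨x, hx⟩ - ⟨z, hz⟩ - h
    simpa using h
  · intro f hf
    simp only [Finset.mem_filter, Finset.mem_univ, true_and] at hf
    have h : L f = y := funext fun i => hf i
    exact ⟨⟨f - f₀, by rw [LinearMap.mem_ker, map_sub, h, hf₀, sub_self]⟩, Finset.mem_univ _,
      sub_add_cancel f f₀⟩

/-- Every anti-flag is `(⟨v⟩, f^⊥)` for vectors with `v ⬝ᵥ f = 1`. -/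
theorem AntiFlag.exists_rep (A : AntiFlag F n) :
    ∃ p : (Fin n → F) × (Fin n → F), p.1 ⬝ᵥ p.2 = 1 ∧ A.pt = Submodule.span F {p.1} ∧
      ∀ x, x ∈ A.hyp ↔ x ⬝ᵥ p.2 = 0 := by
  obtain ⟨v, hv, hspan⟩ := finrank_eq_one_iff'.1 A.pt_rank
  have hpt : A.pt = Submodule.span F {v.1} := by
    ext x
    rw [Submodule.mem_span_singleton]
    constructor
    · intro hx
      obtain ⟨c, hc⟩ := hspan ⟨x, hx⟩
      exact ⟨c, congrArg Subtype.val hc⟩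
    · rintro ⟨c, rfl⟩
      exact A.pt.smul_mem c v.2
  have hvH : v.1 ∉ A.hyp := fun h => A.not_incident (by
    rw [hpt, Submodule.span_singleton_le_iff_mem]; exact h)
  obtain ⟨f, hf, hle⟩ := Submodule.exists_le_ker_of_notMem hvH
  have hfd : ∀ x, f x = x ⬝ᵥ fun i => f (fun j => if i = j then 1 else 0) := fun x => by
    rw [LinearMap.pi_apply_eq_sum_univ f x]; rfl
  have hker : A.hyp = LinearMap.ker f := by
    apply Submodule.eq_of_le_of_finrank_eq hle
    have h1 := LinearMap.finrank_range_add_finrank_ker f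
    have h2 : LinearMap.range f = ⊤ := LinearMap.range_eq_top.2
      (LinearMap.surjective_of_ne_zero fun h => hf (by rw [h]; rfl))
    rw [h2, finrank_top, finrank_self, finrank_fin_fun] at h1
    rw [A.hyp_rank]; omega
  refine ⟨((f v.1)⁻¹ • v.1, fun i => f (fun j => if i = j then 1 else 0)), ?_, ?_, ?_⟩
  · rw [smul_dotProduct, ← hfd, smul_eq_mul, inv_mul_cancel₀ hf]
  · exact hpt.trans (Submodule.span_singleton_smul_eq (IsUnit.mk0 _ (inv_ne_zero hf)) _).symm
  · intro x
    rw [← hfd, hker, LinearMap.mem_ker]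

/-- A chosen pair `(v, f)` with `v ⬝ᵥ f = 1` representing an anti-flag as `(⟨v⟩, f^⊥)`. -/
noncomputable def AntiFlag.rep (A : AntiFlag F n) : (Fin n → F) × (Fin n → F) :=
  A.exists_rep.choose

theorem AntiFlag.rep_dotProduct (A : AntiFlag F n) : A.rep.1 ⬝ᵥ A.rep.2 = 1 :=
  A.exists_rep.choose_spec.1

theorem AntiFlag.pt_eq_span (A : AntiFlag F n) : A.pt = Submodule.span F {A.rep.1} :=
  A.exists_rep.choose_spec.2.1

theorem AntiFlag.mem_hyp_iff (A : AntiFlag F n) (x : Fin n → F) :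
    x ∈ A.hyp ↔ x ⬝ᵥ A.rep.2 = 0 :=
  A.exists_rep.choose_spec.2.2 x

theorem AntiFlag.pt_le_hyp_iff (A B : AntiFlag F n) :
    A.pt ≤ B.hyp ↔ A.rep.1 ⬝ᵥ B.rep.2 = 0 := by
  rw [A.pt_eq_span, Submodule.span_singleton_le_iff_mem, B.mem_hyp_iff]

theorem AntiFlag.ext_of_eq {A B : AntiFlag F n} (hp : A.pt = B.pt) (hh : A.hyp = B.hyp) :
    A = B := by
  cases A; cases B; simp_all

/-- Two vectors with the same orthogonal complement, one of them pairing to `1` with `u`,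
are proportional. -/
theorem eq_smul_of_dotProduct_eq_zero {u f g : Fin n → F} (hu : u ⬝ᵥ g = 1)
    (h : ∀ x, x ⬝ᵥ g = 0 → x ⬝ᵥ f = 0) : f = (u ⬝ᵥ f) • g := by
  apply dotProduct_eq
  intro x
  have := h (x - (x ⬝ᵥ g) • u) (by rw [sub_dotProduct, smul_dotProduct, hu]; simp)
  rw [sub_dotProduct, smul_dotProduct, sub_eq_zero, smul_eq_mul] at this
  rw [dotProduct_comm, this, smul_dotProduct, smul_eq_mul, dotProduct_comm g x]
  ring

/-- The anti-flag `(⟨v⟩, f^⊥)` has `(v, f)` among the rescalings of its representative. -/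
theorem AntiFlag.exists_rep_eq {v f : Fin n → F} (h : v ⬝ᵥ f = 1) :
    ∃ (B : AntiFlag F n) (t : Fˣ), (t • B.rep.1, t⁻¹ • B.rep.2) = (v, f) := by
  have hv : v ≠ 0 := by rintro rfl; simp at h
  let φ : (Fin n → F) →ₗ[F] F := (dotProductBilin F F).flip f
  have hφ : ∀ x, φ x = x ⬝ᵥ f := fun x => rfl
  let B : AntiFlag F n :=
    { pt := Submodule.span F {v}
      hyp := LinearMap.ker φ
      pt_rank := finrank_span_singleton hv
      hyp_rank := by
        have h1 := LinearMap.finrank_range_add_finrank_ker φ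
        have h2 : LinearMap.range φ = ⊤ := LinearMap.range_eq_top.2
          (LinearMap.surjective_of_ne_zero fun h0 => by
            have := hφ v; rw [h0, h] at this; simp at this)
        rw [h2, finrank_top, finrank_self, finrank_fin_fun] at h1
        omega
      not_incident := by
        rw [Submodule.span_singleton_le_iff_mem, LinearMap.mem_ker, hφ, h]
        exact one_ne_zero }
  have hBp : Submodule.span F {v} = Submodule.span F {B.rep.1} := B.pt_eq_span
  have hBh : ∀ x, x ⬝ᵥ f = 0 ↔ x ⬝ᵥ B.rep.2 = 0 := fun x => B.mem_hyp_iff x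
  have hmem : v ∈ Submodule.span F {B.rep.1} := hBp ▸ Submodule.mem_span_singleton_self v
  obtain ⟨t, htv⟩ := Submodule.mem_span_singleton.1 hmem
  have hf := eq_smul_of_dotProduct_eq_zero B.rep_dotProduct fun x hx => (hBh x).2 hx
  have ht : t ≠ 0 := by rintro rfl; exact hv (by rw [← htv, zero_smul])
  have hts : B.rep.1 ⬝ᵥ f = t⁻¹ := by
    rw [← htv, smul_dotProduct, smul_eq_mul] at h
    exact eq_inv_of_mul_eq_one_right h
  refine ⟨B, Units.mk0 t ht, Prod.ext htv ?_⟩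
  rw [hts] at hf
  exact hf.symm

theorem AntiFlag.smul_rep_injective : Function.Injective
    fun x : AntiFlag F n × Fˣ => ((x.2 • x.1.rep.1, x.2⁻¹ • x.1.rep.2) :
      (Fin n → F) × (Fin n → F)) := by
  rintro ⟨A, s⟩ ⟨B, t⟩ h
  obtain ⟨h1, h2⟩ := Prod.ext_iff.1 h
  simp only at h1 h2
  have hAB : A = B := by
    apply AntiFlag.ext_of_eq
    · rw [A.pt_eq_span, B.pt_eq_span, ← Submodule.span_singleton_group_smul_eq F s, h1,
        Submodule.span_singleton_group_smul_eq]
    · ext x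
      rw [A.mem_hyp_iff, B.mem_hyp_iff, ← smul_eq_zero_iff_eq s⁻¹, ← dotProduct_smul, h2,
        dotProduct_smul, smul_eq_zero_iff_eq]
  subst hAB
  have := congrArg (· ⬝ᵥ A.rep.2) h1
  simp only [smul_dotProduct, A.rep_dotProduct, Units.smul_def, smul_eq_mul, mul_one] at this
  rw [Units.ext this]

theorem adj1_iff_xor (A B : AntiFlag F n) :
    adj1 A B ↔ Xor (B.rep.1 ⬝ᵥ A.rep.2 = 0) (A.rep.1 ⬝ᵥ B.rep.2 = 0) := by
  have hne : Xor (B.rep.1 ⬝ᵥ A.rep.2 = 0) (A.rep.1 ⬝ᵥ B.rep.2 = 0) → A ≠ B := by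
    rintro h rfl
    simp at h
  unfold adj1
  rw [A.pt_le_hyp_iff, B.pt_le_hyp_iff]
  unfold Xor at *
  tauto

open scoped Classical in
/-- Counting the common `1`-neighbours of two anti-flags by counting their representatives. -/
theorem ncard_perpSet_mul [Fintype F] (A₁ A₂ : AntiFlag F n) :
    (perpSet adj1 {A₁, A₂}).ncard * (Fintype.card F - 1) =
    (Finset.univ.filter fun p : (Fin n → F) × (Fin n → F) => p.1 ⬝ᵥ p.2 = 1 ∧
      Xor (p.1 ⬝ᵥ A₁.rep.2 = 0) (A₁.rep.1 ⬝ᵥ p.2 = 0) ∧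
      Xor (p.1 ⬝ᵥ A₂.rep.2 = 0) (A₂.rep.1 ⬝ᵥ p.2 = 0)).card := by
  rw [← Fintype.card_units, ← Nat.card_eq_fintype_card, ← Set.ncard_univ, ← Set.ncard_prod,
    ← Set.ncard_image_of_injective _ AntiFlag.smul_rep_injective, ← Set.ncard_coe_finset]
  congr 1
  ext ⟨v, f⟩
  simp only [Set.mem_image, Set.mem_prod, Set.mem_univ, and_true, Prod.exists,
    Finset.coe_filter, Finset.mem_univ, true_and, Set.mem_ofPred_eq]
  have key : ∀ (B A : AntiFlag F n) (t : Fˣ), adj1 A B ↔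
      Xor ((t • B.rep.1) ⬝ᵥ A.rep.2 = 0) (A.rep.1 ⬝ᵥ (t⁻¹ • B.rep.2) = 0) := by
    intro B A t
    rw [adj1_iff_xor, smul_dotProduct, dotProduct_smul, smul_eq_zero_iff_eq,
      smul_eq_zero_iff_eq]
  constructor
  · rintro ⟨B, t, hB, h⟩
    obtain ⟨rfl, rfl⟩ := Prod.ext_iff.1 h
    refine ⟨?_, (key B A₁ t).1 (hB _ (by simp)), (key B A₂ t).1 (hB _ (by simp))⟩
    simp only [smul_dotProduct, dotProduct_smul, B.rep_dotProduct, smul_smul, inv_mul_cancel,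
      one_smul]
  · rintro ⟨h, h1, h2⟩
    obtain ⟨B, t, hB⟩ := AntiFlag.exists_rep_eq h
    obtain ⟨rfl, rfl⟩ := Prod.ext_iff.1 hB
    refine ⟨B, t, ?_, rfl⟩
    rintro A (rfl | rfl)
    · exact (key B _ t).2 h1
    · exact (key B _ t).2 h2

theorem Finset.card_eq_card_mul_of_fiberwise {α β : Type*} [DecidableEq β] {s : Finset α}
    {t : Finset β} {m : ℕ} (f : α → β) (hf : ∀ x ∈ s, f x ∈ t)
    (h : ∀ b ∈ t, (s.filter fun x => f x = b).card = m) : s.card = t.card * m := by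
  rw [Finset.card_eq_sum_card_fiberwise hf, Finset.sum_const_nat h]

open scoped Classical in
/-- Counting pairs whose first entry lies in `D` and has exactly `m` partners. -/
theorem card_filter_prod_eq_mul {α β : Type*} [Fintype α] [Fintype β] (P : α → β → Prop)
    {_ : DecidablePred fun p : α × β => P p.1 p.2} (D : Finset α) (m : ℕ) (hD : ∀ a b, P a b → a ∈ D)
    (h : ∀ a ∈ D, (Finset.univ.filter fun b => P a b).card = m) :
    (Finset.univ.filter fun p : α × β => P p.1 p.2).card = D.card * m := by
  refine Finset.card_eq_card_mul_of_fiberwise Prod.fst (fun x hx => hD _ _ (by simpa using hx)) ?_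
  intro a ha
  rw [← h a ha]
  refine Finset.card_bij (fun p _ => p.2) ?_ ?_ ?_
  · rintro ⟨x, y⟩ hp
    simp only [Finset.mem_filter, Finset.mem_univ, true_and] at hp ⊢
    rw [← hp.2]; exact hp.1
  · rintro ⟨x, y⟩ hp ⟨x', y'⟩ hp' h'
    simp only [Finset.mem_filter, Finset.mem_univ, true_and] at hp hp' h'
    rw [hp.2, hp'.2, h']
  · intro b hb
    exact ⟨(a, b), by simpa using hb, rfl⟩

open scoped Classical in
theorem card_filter_dotProduct_eq_two [Fintype F] {u v : Fin n → F}
    (h : LinearIndependent F ![u, v]) (a b : F) :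
    (Finset.univ.filter fun x : Fin n → F => x ⬝ᵥ u = a ∧ x ⬝ᵥ v = b).card =
      Fintype.card F ^ (n - 2) := by
  rw [← card_filter_dotProduct_eq ![u, v] h ![a, b]]
  congr 1
  ext x
  simp [Fin.forall_fin_two, dotProduct_comm x]

open scoped Classical in
theorem card_filter_dotProduct_eq_three [Fintype F] {u v w : Fin n → F}
    (h : LinearIndependent F ![u, v, w]) (a b c : F) :
    (Finset.univ.filter fun x : Fin n → F => u ⬝ᵥ x = a ∧ v ⬝ᵥ x = b ∧ w ⬝ᵥ x = c).card =
      Fintype.card F ^ (n - 3) := by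
  rw [← card_filter_dotProduct_eq ![u, v, w] h ![a, b, c]]
  congr 1
  ext x
  simp [Fin.forall_fin_succ]

open scoped Classical in
theorem card_filter_xor_eq_zero [Fintype F] :
    (Finset.univ.filter fun x : F × F => Xor (x.1 = 0) (x.2 = 0)).card =
      2 * (Fintype.card F - 1) := by
  have h : (Finset.univ.filter fun x : F × F => Xor (x.1 = 0) (x.2 = 0)) =
      ({0} ×ˢ Finset.univ.erase 0) ∪ (Finset.univ.erase 0 ×ˢ {0}) := by
    ext ⟨a, b⟩
    simp only [Finset.mem_filter, Finset.mem_univ, true_and, Finset.mem_union,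
      Finset.mem_product, Finset.mem_singleton, Finset.mem_erase, and_true]
    unfold Xor
    tauto
  rw [h, Finset.card_union_of_disjoint]
  · simp [Finset.card_erase_of_mem]; ring
  · rw [Finset.disjoint_left]
    rintro ⟨a, b⟩ h h'
    simp only [Finset.mem_product, Finset.mem_singleton, Finset.mem_erase] at h h'
    exact h'.1.1 h.1

theorem linearIndependent_pair_of_ne {v w f : Fin n → F} (hw : w ⬝ᵥ f ≠ 0)
    (hv : v ≠ (v ⬝ᵥ f / w ⬝ᵥ f) • w) : LinearIndependent F ![v, w] := by
  rw [LinearIndependent.pair_iff]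
  intro s t h
  have hf := congrArg (· ⬝ᵥ f) h
  simp only [add_dotProduct, smul_dotProduct, smul_eq_mul, zero_dotProduct] at hf
  have hs : s = 0 := by
    by_contra hs
    apply hv
    have ht : v ⬝ᵥ f / w ⬝ᵥ f = - (s⁻¹ * t) := by
      field_simp
      linear_combination hf
    rw [ht, neg_smul, mul_smul, eq_neg_iff_add_eq_zero, ← smul_right_injective _ hs |>.eq_iff,
      smul_add, smul_inv_smul₀ hs, smul_zero, h]
  subst hs
  rw [zero_mul, zero_add] at hf
  exact ⟨rfl, (mul_eq_zero.1 hf).resolve_right hw⟩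

theorem linearIndependent_triple_of_ne {v₁ v₂ v f₁ f₂ : Fin n → F} (h₁₁ : v₁ ⬝ᵥ f₁ = 1)
    (h₂₂ : v₂ ⬝ᵥ f₂ = 1) (h₁₂ : v₁ ⬝ᵥ f₂ = 0) (h₂₁ : v₂ ⬝ᵥ f₁ = 0)
    (hv : v ≠ (v ⬝ᵥ f₁) • v₁ + (v ⬝ᵥ f₂) • v₂) : LinearIndependent F ![v₁, v₂, v] := by
  rw [Fintype.linearIndependent_iff]
  intro g hg
  simp only [Fin.sum_univ_three, Matrix.cons_val] at hg
  have e₁ := congrArg (· ⬝ᵥ f₁) hg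
  have e₂ := congrArg (· ⬝ᵥ f₂) hg
  simp only [add_dotProduct, smul_dotProduct, smul_eq_mul, zero_dotProduct, h₁₁, h₂₂, h₁₂,
    h₂₁, mul_one, mul_zero, zero_add, add_zero] at e₁ e₂
  have e₃ : g 2 = 0 := by
    by_contra h
    apply hv
    apply smul_right_injective _ h
    simp only [smul_add, smul_smul]
    rw [eq_neg_of_add_eq_zero_right e₁, eq_neg_of_add_eq_zero_right e₂,
      eq_neg_of_add_eq_zero_right hg]
    module
  rw [e₃] at e₁ e₂
  simp only [zero_mul, add_zero] at e₁ e₂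
  simp [Fin.forall_fin_succ, e₁, e₂, e₃]

open scoped Classical in
theorem card_representatives_of_adj2 [Fintype F] {v₁ v₂ f₁ f₂ : Fin n → F}
    (h₁₁ : v₁ ⬝ᵥ f₁ = 1) (h₂₂ : v₂ ⬝ᵥ f₂ = 1) (h₁₂ : v₁ ⬝ᵥ f₂ = 0) (h₂₁ : v₂ ⬝ᵥ f₁ = 0) :
    (Finset.univ.filter fun p : (Fin n → F) × (Fin n → F) => p.1 ⬝ᵥ p.2 = 1 ∧
      Xor (p.1 ⬝ᵥ f₁ = 0) (v₁ ⬝ᵥ p.2 = 0) ∧ Xor (p.1 ⬝ᵥ f₂ = 0) (v₂ ⬝ᵥ p.2 = 0)).card =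
    (2 * (Fintype.card F - 1)) * (2 * (Fintype.card F - 1)) *
      ((Fintype.card F ^ (n - 2) - 1) * Fintype.card F ^ (n - 3)) := by
  have hf : LinearIndependent F ![f₁, f₂] := by
    rw [LinearIndependent.pair_iff]
    intro s t h
    have e₁ := congrArg (v₁ ⬝ᵥ ·) h
    have e₂ := congrArg (v₂ ⬝ᵥ ·) h
    simp only [dotProduct_add, dotProduct_smul, smul_eq_mul, dotProduct_zero] at e₁ e₂
    simp_all
  rw [← card_filter_xor_eq_zero, ← Finset.card_product]
  refine Finset.card_eq_card_mul_of_fiberwise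
    (fun p => ((p.1 ⬝ᵥ f₁, v₁ ⬝ᵥ p.2), (p.1 ⬝ᵥ f₂, v₂ ⬝ᵥ p.2))) ?_ ?_
  · intro p hp
    simp only [Finset.mem_filter, Finset.mem_univ, true_and] at hp
    simpa using hp.2
  rintro ⟨⟨a, c⟩, ⟨b, d⟩⟩ hz
  simp only [Finset.mem_product, Finset.mem_filter, Finset.mem_univ, true_and] at hz
  obtain ⟨hac, hbd⟩ := hz
  have hac0 : a * c = 0 := by rcases hac with h | h <;> simp [h.1]
  have hbd0 : b * d = 0 := by rcases hbd with h | h <;> simp [h.1]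
  have hD : ((Finset.univ.filter fun x : Fin n → F => x ⬝ᵥ f₁ = a ∧ x ⬝ᵥ f₂ = b).erase
      (a • v₁ + b • v₂)).card = Fintype.card F ^ (n - 2) - 1 := by
    rw [Finset.card_erase_of_mem, card_filter_dotProduct_eq_two hf]
    simp [h₁₁, h₂₂, h₁₂, h₂₁]
  rw [Finset.filter_filter, ← hD]
  simp only [Prod.mk.injEq]
  refine card_filter_prod_eq_mul (fun x y : Fin n → F => (x ⬝ᵥ y = 1 ∧
      Xor (x ⬝ᵥ f₁ = 0) (v₁ ⬝ᵥ y = 0) ∧ Xor (x ⬝ᵥ f₂ = 0) (v₂ ⬝ᵥ y = 0)) ∧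
      (x ⬝ᵥ f₁ = a ∧ v₁ ⬝ᵥ y = c) ∧ x ⬝ᵥ f₂ = b ∧ v₂ ⬝ᵥ y = d) _ _ ?_ ?_
  · rintro x y ⟨⟨h, -⟩, ⟨rfl, rfl⟩, rfl, rfl⟩
    simp only [Finset.mem_erase, Finset.mem_filter, Finset.mem_univ, and_self, and_true]
    intro hx
    have := congrArg (· ⬝ᵥ y) hx
    simp [h, hac0, hbd0] at this
  · intro x hx
    simp only [Finset.mem_erase, Finset.mem_filter, Finset.mem_univ, true_and] at hx
    obtain ⟨hx, rfl, rfl⟩ := hx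
    rw [← card_filter_dotProduct_eq_three
      (linearIndependent_triple_of_ne h₁₁ h₂₂ h₁₂ h₂₁ hx) c d 1]
    congr 1
    ext y
    simp only [Finset.mem_filter, Finset.mem_univ, true_and]
    constructor
    · tauto
    · rintro ⟨rfl, rfl, h⟩
      tauto

open scoped Classical in
theorem card_representatives_of_adj3 [Fintype F] (hn : 2 ≤ n) {w f₁ f₂ : Fin n → F}
    (h₁ : w ⬝ᵥ f₁ ≠ 0) (h₂ : w ⬝ᵥ f₂ ≠ 0) (hf : LinearIndependent F ![f₁, f₂]) :
    (Finset.univ.filter fun p : (Fin n → F) × (Fin n → F) => p.1 ⬝ᵥ p.2 = 1 ∧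
      Xor (p.1 ⬝ᵥ f₁ = 0) (w ⬝ᵥ p.2 = 0) ∧ Xor (p.1 ⬝ᵥ f₂ = 0) (w ⬝ᵥ p.2 = 0)).card =
    (Fintype.card F ^ (2 * n - 3) - 2 * Fintype.card F ^ (n - 2)) * (Fintype.card F - 1) := by
  have hw0 : w ≠ 0 := by rintro rfl; simp at h₁
  set E : Finset F := Finset.univ.erase 0 with hE
  have hEc : E.card = Fintype.card F - 1 := by simp [hE, Finset.card_erase_of_mem]
  set S := Finset.univ.filter fun x : Fin n → F => x ⬝ᵥ f₁ ≠ 0 ∧ x ⬝ᵥ f₂ ≠ 0 with hS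
  have hSc : S.card = (Fintype.card F - 1) * (Fintype.card F - 1) * Fintype.card F ^ (n - 2) := by
    rw [← hEc, ← Finset.card_product]
    refine Finset.card_eq_card_mul_of_fiberwise (fun x => (x ⬝ᵥ f₁, x ⬝ᵥ f₂)) ?_ ?_
    · intro x hx
      simpa [hS, hE] using hx
    · rintro ⟨a, b⟩ hab
      rw [← card_filter_dotProduct_eq_two hf a b, hS, Finset.filter_filter]
      congr 1
      ext x
      simp [hE] at hab ⊢
      rintro rfl rfl
      exact hab
  have hL : (E.image (· • w)).card = Fintype.card F - 1 := by
    rw [Finset.card_image_of_injective _ (smul_left_injective _ hw0), hEc]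
  have hLS : E.image (· • w) ⊆ S := by
    intro x hx
    obtain ⟨c, hc, rfl⟩ := Finset.mem_image.1 hx
    simp_all
  have hDc : (S \ E.image (· • w)).card =
      (Fintype.card F - 1) * (Fintype.card F - 1) * Fintype.card F ^ (n - 2) -
        (Fintype.card F - 1) := by
    rw [Finset.card_sdiff_of_subset hLS, hL, hSc]
  have hKc : ((Finset.univ.filter fun x : Fin n → F => x ⬝ᵥ f₁ = 0 ∧ x ⬝ᵥ f₂ = 0).erase 0).card =
      Fintype.card F ^ (n - 2) - 1 := by
    rw [Finset.card_erase_of_mem (by simp), card_filter_dotProduct_eq_two hf]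
  have c₁ : (Finset.univ.filter fun p : (Fin n → F) × (Fin n → F) => p.1 ⬝ᵥ p.2 = 1 ∧
      w ⬝ᵥ p.2 = 0 ∧ p.1 ⬝ᵥ f₁ ≠ 0 ∧ p.1 ⬝ᵥ f₂ ≠ 0).card =
      (S \ E.image (· • w)).card * Fintype.card F ^ (n - 2) := by
    refine card_filter_prod_eq_mul (fun x y : Fin n → F => x ⬝ᵥ y = 1 ∧
      w ⬝ᵥ y = 0 ∧ x ⬝ᵥ f₁ ≠ 0 ∧ x ⬝ᵥ f₂ ≠ 0) _ _ ?_ ?_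
    · rintro x y ⟨h, hy, hx⟩
      rw [Finset.mem_sdiff]
      refine ⟨by simpa [hS] using hx, fun hx' => ?_⟩
      obtain ⟨c, hc, rfl⟩ := Finset.mem_image.1 hx'
      simp [hy] at h
    · intro x hx
      rw [Finset.mem_sdiff, hS, Finset.mem_filter] at hx
      obtain ⟨⟨-, hx⟩, hx'⟩ := hx
      have hli : LinearIndependent F ![x, w] := linearIndependent_pair_of_ne h₁ fun h =>
        hx' (Finset.mem_image.2 ⟨_, by simp [hE, hx.1, h₁], h.symm⟩)
      rw [← card_filter_dotProduct_eq_two hli 1 0]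
      congr 1
      ext y
      simp [hx, dotProduct_comm y]
  have c₂ : (Finset.univ.filter fun p : (Fin n → F) × (Fin n → F) => p.1 ⬝ᵥ p.2 = 1 ∧
      w ⬝ᵥ p.2 ≠ 0 ∧ p.1 ⬝ᵥ f₁ = 0 ∧ p.1 ⬝ᵥ f₂ = 0).card =
      ((Finset.univ.filter fun x : Fin n → F => x ⬝ᵥ f₁ = 0 ∧ x ⬝ᵥ f₂ = 0).erase 0).card *
        ((Fintype.card F - 1) * Fintype.card F ^ (n - 2)) := by
    refine card_filter_prod_eq_mul (fun x y : Fin n → F => x ⬝ᵥ y = 1 ∧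
      w ⬝ᵥ y ≠ 0 ∧ x ⬝ᵥ f₁ = 0 ∧ x ⬝ᵥ f₂ = 0) _ _ ?_ ?_
    · rintro x y ⟨h, hy, hx⟩
      refine Finset.mem_erase.2 ⟨?_, by simpa using hx⟩
      rintro rfl
      simp at h
    · intro x hx
      simp only [Finset.mem_erase, Finset.mem_filter, Finset.mem_univ, true_and] at hx
      have hli : LinearIndependent F ![x, w] := linearIndependent_pair_of_ne h₁ (by
        rw [hx.2.1, zero_div, zero_smul]; exact hx.1)
      rw [← hEc]
      refine Finset.card_eq_card_mul_of_fiberwise (fun y => w ⬝ᵥ y) ?_ ?_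
      · intro y hy
        simp only [Finset.mem_filter, Finset.mem_univ, true_and] at hy
        simpa [hE] using hy.2.1
      · intro c hc
        rw [← card_filter_dotProduct_eq_two hli 1 c, Finset.filter_filter]
        congr 1
        ext y
        simp only [hE, Finset.mem_erase, Finset.mem_univ, and_true] at hc
        simp only [Finset.mem_filter, Finset.mem_univ, true_and, dotProduct_comm y]
        constructor
        · tauto
        · rintro ⟨h, rfl⟩
          tauto
  rw [← Finset.card_filter_add_card_filter_not (fun p => w ⬝ᵥ p.2 = 0),
    Finset.filter_filter, Finset.filter_filter]
  have s₁ : ∀ p : (Fin n → F) × (Fin n → F), ((p.1 ⬝ᵥ p.2 = 1 ∧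
      Xor (p.1 ⬝ᵥ f₁ = 0) (w ⬝ᵥ p.2 = 0) ∧ Xor (p.1 ⬝ᵥ f₂ = 0) (w ⬝ᵥ p.2 = 0)) ∧
      w ⬝ᵥ p.2 = 0) ↔ (p.1 ⬝ᵥ p.2 = 1 ∧
      w ⬝ᵥ p.2 = 0 ∧ p.1 ⬝ᵥ f₁ ≠ 0 ∧ p.1 ⬝ᵥ f₂ ≠ 0) := by
    intro p; unfold Xor; tauto
  have s₂ : ∀ p : (Fin n → F) × (Fin n → F), ((p.1 ⬝ᵥ p.2 = 1 ∧
      Xor (p.1 ⬝ᵥ f₁ = 0) (w ⬝ᵥ p.2 = 0) ∧ Xor (p.1 ⬝ᵥ f₂ = 0) (w ⬝ᵥ p.2 = 0)) ∧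
      ¬ w ⬝ᵥ p.2 = 0) ↔ (p.1 ⬝ᵥ p.2 = 1 ∧
      w ⬝ᵥ p.2 ≠ 0 ∧ p.1 ⬝ᵥ f₁ = 0 ∧ p.1 ⬝ᵥ f₂ = 0) := by
    intro p; unfold Xor; tauto
  simp only [s₁, s₂]
  rw [c₁, c₂, hDc, hKc]
  obtain ⟨r, hr⟩ : ∃ r, Fintype.card F = r + 2 :=
    ⟨_, (Nat.sub_add_cancel Fintype.one_lt_card).symm⟩
  obtain ⟨x, hx⟩ : ∃ x, Fintype.card F ^ (n - 2) = x + 1 :=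
    ⟨_, (Nat.sub_add_cancel (Nat.one_le_pow _ _ Fintype.card_pos)).symm⟩
  have hpow : Fintype.card F ^ (2 * n - 3) = (r + 2) * ((x + 1) * (x + 1)) := by
    rw [← hx, ← hr, ← pow_add, ← pow_succ']
    congr 1; omega
  rw [hpow, hx, hr]
  have e₁ : r + 2 - 1 = r + 1 := rfl
  have e₂ : (r + 1) * (r + 1) * (x + 1) - (r + 1) = (r + 1) * (r + x * (r + 1)) := by
    rw [Nat.sub_eq_iff_eq_add (by nlinarith [Nat.zero_le (r * x), Nat.zero_le (r * r * x)])]; ring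
  have e₃ : (r + 2) * ((x + 1) * (x + 1)) - 2 * (x + 1) = (x + 1) * (r * (x + 1) + 2 * x) := by
    rw [Nat.sub_eq_iff_eq_add (by nlinarith [Nat.zero_le (r * x), Nat.zero_le (r * x * x)])]; ring
  rw [e₁, e₂, e₃, Nat.add_sub_cancel]
  ring

theorem linearIndependent_pair_of_not_forall {f g : Fin n → F} (hf : f ≠ 0) (hg : g ≠ 0)
    (h : ¬ ∀ x, x ⬝ᵥ f = 0 ↔ x ⬝ᵥ g = 0) : LinearIndependent F ![f, g] := by
  rw [LinearIndependent.pair_iff' hf]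
  rintro a rfl
  have ha : a ≠ 0 := by rintro rfl; exact hg (zero_smul F f)
  exact h fun x => by simp [ha]

theorem AntiFlag.rep_fst_ne_zero (A : AntiFlag F n) : A.rep.1 ≠ 0 := fun h => by
  have := A.rep_dotProduct
  simp [h] at this

theorem AntiFlag.rep_snd_ne_zero (A : AntiFlag F n) : A.rep.2 ≠ 0 := fun h => by
  have := A.rep_dotProduct
  simp [h] at this

theorem AntiFlag.rep_fst_dotProduct_eq_zero_iff {A B : AntiFlag F n} (h : A.pt = B.pt)
    (x : Fin n → F) : A.rep.1 ⬝ᵥ x = 0 ↔ B.rep.1 ⬝ᵥ x = 0 := by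
  have hmem : A.rep.1 ∈ Submodule.span F {B.rep.1} := by
    rw [← B.pt_eq_span, ← h, A.pt_eq_span]
    exact Submodule.mem_span_singleton_self _
  obtain ⟨c, hc⟩ := Submodule.mem_span_singleton.1 hmem
  have hc0 : c ≠ 0 := by
    rintro rfl
    exact A.rep_fst_ne_zero (by rw [← hc, zero_smul])
  rw [← hc, smul_dotProduct, smul_eq_mul, mul_eq_zero, or_iff_right hc0]

theorem AntiFlag.dotProduct_rep_snd_eq_zero_iff {A B : AntiFlag F n} (h : A.hyp = B.hyp)
    (x : Fin n → F) : x ⬝ᵥ A.rep.2 = 0 ↔ x ⬝ᵥ B.rep.2 = 0 := by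
  rw [← A.mem_hyp_iff, ← B.mem_hyp_iff, h]

theorem AntiFlag.pt_eq_of_forall {A B : AntiFlag F n}
    (h : ∀ x, x ⬝ᵥ A.rep.1 = 0 ↔ x ⬝ᵥ B.rep.1 = 0) : A.pt = B.pt := by
  have hB := eq_smul_of_dotProduct_eq_zero
    ((dotProduct_comm _ _).trans A.rep_dotProduct) fun x hx => (h x).1 hx
  have hA := eq_smul_of_dotProduct_eq_zero
    ((dotProduct_comm _ _).trans B.rep_dotProduct) fun x hx => (h x).2 hx
  rw [A.pt_eq_span, B.pt_eq_span]
  apply le_antisymm <;> rw [Submodule.span_singleton_le_iff_mem, Submodule.mem_span_singleton]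
  · exact ⟨_, hA.symm⟩
  · exact ⟨_, hB.symm⟩

theorem stmt14 [Fintype F] {q : ℕ} (hq : Fintype.card F = q) (hn : 3 ≤ n)
    (A1 A2 : AntiFlag F n) (hne : A1 ≠ A2) (hnot1 : ¬ adj1 A1 A2) :
    (adj2 A1 A2 →
      (perpSet adj1 {A1, A2}).ncard = 4 * (q ^ (n - 2) - 1) * (q - 1) * q ^ (n - 3)) ∧
    (adj3 A1 A2 →
      (perpSet adj1 {A1, A2}).ncard = q ^ (2 * n - 3) - 2 * q ^ (n - 2)) := by
  subst hq
  classical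
  have hq0 : 0 < Fintype.card F - 1 := Nat.sub_pos_of_lt Fintype.one_lt_card
  have count := ncard_perpSet_mul A1 A2
  refine ⟨fun h => ?_, fun h => ?_⟩ <;> apply Nat.eq_of_mul_eq_mul_right hq0
  · rw [count, card_representatives_of_adj2 A1.rep_dotProduct A2.rep_dotProduct
      ((A1.pt_le_hyp_iff A2).1 h.2.1) ((A2.pt_le_hyp_iff A1).1 h.2.2)]
    ring
  · rcases h.2 with hp | hh
    · have hpt := AntiFlag.rep_fst_dotProduct_eq_zero_iff hp
      have hli : LinearIndependent F ![A1.rep.2, A2.rep.2] :=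
        linearIndependent_pair_of_not_forall A1.rep_snd_ne_zero A2.rep_snd_ne_zero fun h' =>
          hne (AntiFlag.ext_of_eq hp (Submodule.ext fun x => by
            rw [A1.mem_hyp_iff, A2.mem_hyp_iff, h']))
      simp only [← hpt] at count
      rw [count]
      exact card_representatives_of_adj3 (by omega) (by simp [A1.rep_dotProduct])
        (by rw [Ne, hpt]; simp [A2.rep_dotProduct]) hli
    · have hhyp := AntiFlag.dotProduct_rep_snd_eq_zero_iff hh
      have hli : LinearIndependent F ![A1.rep.1, A2.rep.1] :=
        linearIndependent_pair_of_not_forall A1.rep_fst_ne_zero A2.rep_fst_ne_zero fun h' =>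
          hne (AntiFlag.ext_of_eq (AntiFlag.pt_eq_of_forall h') hh)
      simp only [← hhyp] at count
      rw [count, ← card_representatives_of_adj3 (by omega)
        (by rw [dotProduct_comm, A1.rep_dotProduct]; exact one_ne_zero)
        (by rw [Ne, dotProduct_comm, hhyp]; simp [A2.rep_dotProduct]) hli]
      refine Finset.card_equiv (Equiv.prodComm _ _) fun p => ?_
      simp only [Finset.mem_filter, Finset.mem_univ, true_and, Equiv.prodComm_apply,
        Prod.fst_swap, Prod.snd_swap]
      rw [dotProduct_comm p.2 p.1, dotProduct_comm p.2 A1.rep.1, dotProduct_comm p.2 A2.rep.1,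
        dotProduct_comm A1.rep.2 p.1, xor_comm (p.1 ⬝ᵥ A1.rep.2 = 0) (A1.rep.1 ⬝ᵥ p.2 = 0),
        xor_comm (p.1 ⬝ᵥ A1.rep.2 = 0) (A2.rep.1 ⬝ᵥ p.2 = 0)]
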